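/- arXiv:2312.04371 — 2 statements merged into one kernel-verified Lean document; each statement's English description precedes it below -/
import Mathlib

section
/- Let f, f̄, f̂ : A → ℝ be bounded measurable functions, let c ≥ 0, ρ ∈ [0,1), κ ∈ ℕ, and let N be a positive integer and m an integer with 0 ≤ m ≤ N. Suppose osc(f − f̄) ≤ (1 − m/N)·c·ρ^(κ+1) and osc(f̄ − f̂) ≤ 2·(m/N)·c·ρ^(κ+1). Then |D_KL(π·μ ‖ Gibbs(f)) − D_KL(π·μ ‖ Gibbs(f̂))| ≤ (1 + m/N)·c·ρ^(κ+1), and hence this difference is at most 2·c·ρ^(κ+1). (This is Proposition 2 of the paper: there f = (1/N)·Σ_{j=1}^N Q_j is the average of all agents' Q-functions, f̄ = (1/N)·Σ_{j∈N_i^κ} Q_j the average over the κ-hop neighborhood of agent i with m = |N_i^κ|, f̂ the corresponding average of truncated Q-functions, and the two oscillation hypotheses are exactly the consequences (21) and (22) of the (c,ρ)-exponential decay property.) -/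
open MeasureTheory Real

/-- Partition function `Z(f) = ∫ exp (f a) dμ(a)`. -/
noncomputable def partitionZ {A : Type*} [MeasurableSpace A] (μ : Measure A) (f : A → ℝ) : ℝ :=
  ∫ a, Real.exp (f a) ∂μ

/-- Gibbs measure with density `exp f / Z(f)` with respect to `μ`. -/
noncomputable def gibbs {A : Type*} [MeasurableSpace A] (μ : Measure A) (f : A → ℝ) :
    Measure A :=
  μ.withDensity (fun a => ENNReal.ofReal (Real.exp (f a) / partitionZ μ f))

/-- Kullback–Leibler divergence `D_KL(P ‖ Q) = ∫ log (dP/dQ) dP`. -/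
noncomputable def klDiv {A : Type*} [MeasurableSpace A] (P Q : Measure A) : ℝ :=
  ∫ a, MeasureTheory.llr P Q a ∂P

section

variable {A : Type*} [MeasurableSpace A]

lemma integrable_exp_of_bounded (μ : Measure A) [IsFiniteMeasure μ] {g : A → ℝ}
    (hg : Measurable g) (hgB : ∃ C, ∀ a, |g a| ≤ C) :
    Integrable (fun a => Real.exp (g a)) μ := by
  obtain ⟨C, hC⟩ := hgB
  refine Integrable.of_bound (C := Real.exp C) (by fun_prop) (ae_of_all _ fun a => ?_)
  rw [Real.norm_eq_abs, Real.abs_exp]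
  exact Real.exp_le_exp.2 ((le_abs_self _).trans (hC a))

lemma integrable_of_bounded (μ : Measure A) [IsFiniteMeasure μ] {g : A → ℝ}
    (hg : Measurable g) (hgB : ∃ C, ∀ a, |g a| ≤ C) : Integrable g μ := by
  obtain ⟨C, hC⟩ := hgB
  exact Integrable.of_bound (C := C) (by fun_prop) (ae_of_all _ hC)

/-- The Gibbs variational expansion of the divergence to a Gibbs measure. -/
lemma klDiv_gibbs_eq (μ P : Measure A) [IsFiniteMeasure μ] [IsProbabilityMeasure P]
    (hP : P ≪ μ) (hllr : Integrable (llr P μ) P) {g : A → ℝ}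
    (hg : Measurable g) (hgB : ∃ C, ∀ a, |g a| ≤ C) :
    klDiv P (gibbs μ g) =
      ∫ a, llr P μ a ∂P - ∫ a, g a ∂P + Real.log (partitionZ μ g) :=
  integral_llr_tilted_right hP (integrable_of_bounded P hg hgB)
    (integrable_exp_of_bounded μ hg hgB) hllr

/-- A pointwise bound `f ≤ g + s` gives the same bound for the log-partition functions. -/
lemma log_partitionZ_le_add (μ : Measure A) [IsFiniteMeasure μ] (hμ : μ ≠ 0) {f g : A → ℝ}
    (hf : Integrable (fun a => Real.exp (f a)) μ) (hg : Integrable (fun a => Real.exp (g a)) μ)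
    {s : ℝ} (h : ∀ a, f a ≤ g a + s) :
    Real.log (partitionZ μ f) ≤ Real.log (partitionZ μ g) + s := by
  have : NeZero μ := ⟨hμ⟩
  have hle : partitionZ μ f ≤ partitionZ μ g * Real.exp s := by
    rw [partitionZ, partitionZ, ← integral_mul_const]
    refine integral_mono hf (hg.mul_const _) fun a => ?_
    rw [← Real.exp_add]
    exact Real.exp_le_exp.2 (h a)
  calc Real.log (partitionZ μ f) ≤ Real.log (partitionZ μ g * Real.exp s) :=
        Real.log_le_log (integral_exp_pos hf) hle
    _ = Real.log (partitionZ μ g) + s := by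
        rw [Real.log_mul (x := partitionZ μ g) (integral_exp_pos hg).ne' (Real.exp_ne_zero _),
          Real.log_exp]

/-- The divergence to a Gibbs measure is Lipschitz in the potential, in oscillation seminorm. -/
lemma abs_klDiv_gibbs_sub_le (μ P : Measure A) [IsFiniteMeasure μ] [IsProbabilityMeasure P]
    (hμ : μ ≠ 0) (hP : P ≪ μ) (hllr : Integrable (llr P μ) P) {f g : A → ℝ}
    (hf : Measurable f) (hfB : ∃ C, ∀ a, |f a| ≤ C)
    (hg : Measurable g) (hgB : ∃ C, ∀ a, |g a| ≤ C) {K : ℝ}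
    (hosc : ∀ a a', (f a - g a) - (f a' - g a') ≤ K) :
    |klDiv P (gibbs μ f) - klDiv P (gibbs μ g)| ≤ K := by
  rw [klDiv_gibbs_eq μ P hP hllr hf hfB, klDiv_gibbs_eq μ P hP hllr hg hgB]
  have hfP := integrable_of_bounded P hf hfB
  have hgP := integrable_of_bounded P hg hgB
  have hfe := integrable_exp_of_bounded μ hf hfB
  have hge := integrable_exp_of_bounded μ hg hgB
  obtain ⟨C, hC⟩ := hfB
  obtain ⟨D, hD⟩ := hgB
  have : NeZero μ := ⟨hμ⟩
  have : Nonempty A := μ.nonempty_of_neZero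
  have hbdd : BddBelow (Set.range fun a => f a - g a) := by
    refine ⟨-(C + D), ?_⟩
    rintro _ ⟨a, rfl⟩
    have h1 := abs_le.1 (hC a)
    have h2 := abs_le.1 (hD a)
    show -(C + D) ≤ f a - g a
    linarith
  set l := ⨅ a, (f a - g a)
  have hlow : ∀ a, l ≤ f a - g a := fun a => ciInf_le hbdd a
  have hup : ∀ a, f a - g a ≤ l + K := fun a => by
    have : f a - g a - K ≤ l := le_ciInf fun a' => by linarith [hosc a a']
    linarith
  have hlogup := log_partitionZ_le_add μ hμ hfe hge (s := l + K) fun a => by linarith [hup a]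
  have hloglow := log_partitionZ_le_add μ hμ hge hfe (s := -l) fun a => by linarith [hlow a]
  have hintlow : l ≤ ∫ a, (f a - g a) ∂P := by
    simpa using integral_mono (integrable_const l) (hfP.sub hgP) hlow
  have hintup : ∫ a, (f a - g a) ∂P ≤ l + K := by
    simpa using integral_mono (hfP.sub hgP) (integrable_const (l + K)) hup
  rw [integral_sub hfP hgP] at hintlow hintup
  rw [abs_le]
  constructor <;> linarith

/-- Finite entropy of a density is integrability of the corresponding log-likelihood ratio. -/
lemma integrable_llr_withDensity (μ : Measure A) [SigmaFinite μ] {p : A → ℝ}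
    [SigmaFinite (μ.withDensity fun a => ENNReal.ofReal (p a))]
    (hp : Measurable p) (hp0 : ∀ a, 0 ≤ p a)
    (hent : Integrable (fun a => p a * |Real.log (p a)|) μ) :
    Integrable (llr (μ.withDensity fun a => ENNReal.ofReal (p a)) μ)
      (μ.withDensity fun a => ENNReal.ofReal (p a)) := by
  rw [← integrable_rnDeriv_mul_log_iff (withDensity_absolutelyContinuous _ _)]
  have hpl : Integrable (fun a => p a * Real.log (p a)) μ := by
    refine hent.mono (by fun_prop) (ae_of_all _ fun a => ?_)
    simp
  refine hpl.congr ?_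
  filter_upwards [Measure.rnDeriv_withDensity μ hp.ennreal_ofReal] with a ha
  rw [ha, ENNReal.toReal_ofReal (hp0 a)]

end

theorem stmt_0 {A : Type*} [MeasurableSpace A] (μ : Measure A) [IsFiniteMeasure μ]
    (hμ : μ ≠ 0)
    (f fbar fhat : A → ℝ)
    (hfm : Measurable f) (hfbarm : Measurable fbar) (hfhatm : Measurable fhat)
    (hfB : ∃ C, ∀ a, |f a| ≤ C) (hfbarB : ∃ C, ∀ a, |fbar a| ≤ C)
    (hfhatB : ∃ C, ∀ a, |fhat a| ≤ C)
    (c ρ : ℝ) (hc : 0 ≤ c) (hρ0 : 0 ≤ ρ) (hρ1 : ρ < 1) (κ : ℕ)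
    (N m : ℕ) (hN : 0 < N) (hm : m ≤ N)
    (hosc1 : ∀ a a', (f a - fbar a) - (f a' - fbar a') ≤
      (1 - (m : ℝ) / N) * c * ρ ^ (κ + 1))
    (hosc2 : ∀ a a', (fbar a - fhat a) - (fbar a' - fhat a') ≤
      2 * ((m : ℝ) / N) * c * ρ ^ (κ + 1))
    (pi : A → ℝ) (hpim : Measurable pi) (hpi0 : ∀ a, 0 ≤ pi a)
    (hpi1 : ∫ a, pi a ∂μ = 1)
    (hpient : Integrable (fun a => pi a * |Real.log (pi a)|) μ) :
    |klDiv (μ.withDensity (fun a => ENNReal.ofReal (pi a))) (gibbs μ f) -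
        klDiv (μ.withDensity (fun a => ENNReal.ofReal (pi a))) (gibbs μ fhat)| ≤
      (1 + (m : ℝ) / N) * c * ρ ^ (κ + 1) ∧
    |klDiv (μ.withDensity (fun a => ENNReal.ofReal (pi a))) (gibbs μ f) -
        klDiv (μ.withDensity (fun a => ENNReal.ofReal (pi a))) (gibbs μ fhat)| ≤
      2 * c * ρ ^ (κ + 1) := by
  have hpint : Integrable pi μ := by
    by_contra h
    rw [integral_undef h] at hpi1
    exact zero_ne_one hpi1
  have : IsProbabilityMeasure (μ.withDensity fun a => ENNReal.ofReal (pi a)) := ⟨by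
    rw [withDensity_apply _ MeasurableSet.univ, Measure.restrict_univ,
      ← ofReal_integral_eq_lintegral_ofReal hpint (ae_of_all _ hpi0), hpi1, ENNReal.ofReal_one]⟩
  have hmain := abs_klDiv_gibbs_sub_le μ (μ.withDensity fun a => ENNReal.ofReal (pi a)) hμ
    (withDensity_absolutelyContinuous _ _) (integrable_llr_withDensity μ hpim hpi0 hpient)
    hfm hfB hfhatm hfhatB (K := (1 + (m : ℝ) / N) * c * ρ ^ (κ + 1))
    fun a a' => by linarith [hosc1 a a', hosc2 a a']
  refine ⟨hmain, hmain.trans ?_⟩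
  have hmN : (m : ℝ) / N ≤ 1 := div_le_one_of_le₀ (by exact_mod_cast hm) (by positivity)
  gcongr
  linarith
end

section
/- Let G be a simple graph on a vertex type V with local-state types S_j, deterministic local dynamics Φ as above, a discount factor γ ∈ [0, 1), a bound r̄ ≥ 0, and for a fixed vertex i a reward function r_i : S_i → ℝ with 0 ≤ r_i(x) ≤ r̄ for all x. Define the discounted return from initial global state s as Q_i(s) = Σ_{t=0}^∞ γ^t·r_i( Φ^t(s)(i) ). Then for every κ ∈ ℕ and any two initial global states s, s̃ that agree at every vertex k for which there exists a walk in G from i to k of length at most κ, one has |Q_i(s) − Q_i(s̃)| ≤ (r̄/(1 − γ))·γ^(κ+1). (This is the deterministic-dynamics instance of Proposition 1 of the paper: the discounted local return satisfies the (r̄/(1−γ), γ)-exponential decay property, i.e. the influence on agent i of initial conditions outside its κ-hop neighborhood decays as γ^(κ+1).) -/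
/-- Under local dynamics, the state of `j` at time `t` depends only on the initial states at
vertices within `t` hops of `j`. -/
theorem local_dynamics_eq_of_agree {V : Type*} (G : SimpleGraph V) (S : V → Type*)
    (F : (j : V) → ((k : {k : V // k = j ∨ G.Adj j k}) → S k.val) → S j)
    (Φ : ℕ → ((k : V) → S k) → ((k : V) → S k))
    (hΦ0 : ∀ s, Φ 0 s = s)
    (hΦsucc : ∀ t s j, Φ (t + 1) s j = F j (fun k => Φ t s k.val))
    (s s' : (k : V) → S k) (t : ℕ) (j : V)
    (hagree : ∀ k, (∃ w : G.Walk j k, w.length ≤ t) → s k = s' k) :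
    Φ t s j = Φ t s' j := by
  induction t generalizing j with
  | zero =>
    rw [hΦ0, hΦ0]
    exact hagree j ⟨.nil, le_rfl⟩
  | succ t ih =>
    rw [hΦsucc, hΦsucc]
    congr 1
    funext ⟨k, hk⟩
    refine ih k fun l ⟨w, hw⟩ => hagree l ?_
    rcases hk with rfl | hk
    · exact ⟨w, hw.trans t.le_succ⟩
    · exact ⟨.cons hk w, by simpa using hw⟩

/-- Discounted sums of two `[0, r]`-valued sequences agreeing before time `n` differ by at most
`r / (1 - γ) * γ ^ n`. -/
theorem abs_discounted_tsum_sub_le {γ r : ℝ} (hγ0 : 0 ≤ γ) (hγ1 : γ < 1)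
    {a b : ℕ → ℝ} (ha : ∀ t, 0 ≤ a t ∧ a t ≤ r) (hb : ∀ t, 0 ≤ b t ∧ b t ≤ r)
    {n : ℕ} (hab : ∀ t < n, a t = b t) :
    |(∑' t, γ ^ t * a t) - ∑' t, γ ^ t * b t| ≤ r / (1 - γ) * γ ^ n := by
  have hgeom : HasSum (fun t => γ ^ t * r) ((1 - γ)⁻¹ * r) :=
    (hasSum_geometric_of_lt_one hγ0 hγ1).mul_right r
  have hsum {c : ℕ → ℝ} (hc : ∀ t, 0 ≤ c t ∧ c t ≤ r) : Summable fun t => γ ^ t * c t :=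
    hgeom.summable.of_nonneg_of_le (fun t => mul_nonneg (pow_nonneg hγ0 t) (hc t).1)
      fun t => mul_le_mul_of_nonneg_left (hc t).2 (pow_nonneg hγ0 t)
  have htail : HasSum (fun t => γ ^ (t + n) * r) (r / (1 - γ) * γ ^ n) := by
    have hterm : (fun t => γ ^ (t + n) * r) = fun t => γ ^ n * (γ ^ t * r) := by
      funext t
      ring
    have hval : r / (1 - γ) * γ ^ n = γ ^ n * ((1 - γ)⁻¹ * r) := by ring
    rw [hterm, hval]
    exact hgeom.mul_left _
  rw [← (hsum ha).tsum_sub (hsum hb), ← ((hsum ha).sub (hsum hb)).sum_add_tsum_nat_add n,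
    Finset.sum_eq_zero fun t ht => by rw [hab t (Finset.mem_range.mp ht), sub_self], zero_add,
    ← Real.norm_eq_abs]
  refine tsum_of_norm_bounded htail fun t => ?_
  rw [← mul_sub, Real.norm_eq_abs, abs_mul, abs_of_nonneg (pow_nonneg hγ0 _)]
  refine mul_le_mul_of_nonneg_left ?_ (pow_nonneg hγ0 _)
  exact abs_sub_le_of_nonneg_of_le (ha _).1 (ha _).2 (hb _).1 (hb _).2

theorem stmt_8 {V : Type*} (G : SimpleGraph V) (S : V → Type*)
    (F : (j : V) → ((k : {k : V // k = j ∨ G.Adj j k}) → S k.val) → S j)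
    (Φ : ℕ → ((k : V) → S k) → ((k : V) → S k))
    (hΦ0 : ∀ s, Φ 0 s = s)
    (hΦsucc : ∀ t s j, Φ (t + 1) s j = F j (fun k => Φ t s k.val))
    (γ : ℝ) (hγ0 : 0 ≤ γ) (hγ1 : γ < 1)
    (rbar : ℝ) (hrbar : 0 ≤ rbar)
    (i : V) (ri : S i → ℝ) (hri : ∀ x, 0 ≤ ri x ∧ ri x ≤ rbar)
    (κ : ℕ) (s s' : (k : V) → S k)
    (hagree : ∀ k, (∃ w : G.Walk i k, w.length ≤ κ) → s k = s' k) :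
    |(∑' t : ℕ, γ ^ t * ri (Φ t s i)) - ∑' t : ℕ, γ ^ t * ri (Φ t s' i)| ≤
      (rbar / (1 - γ)) * γ ^ (κ + 1) := by
  refine abs_discounted_tsum_sub_le hγ0 hγ1 (fun _ => hri _) (fun _ => hri _) fun t ht => ?_
  rw [local_dynamics_eq_of_agree G S F Φ hΦ0 hΦsucc s s' t i
    fun k ⟨w, hw⟩ => hagree k ⟨w, hw.trans (Nat.lt_succ_iff.mp ht)⟩]
end
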